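/- arXiv:1902.08484 — 4 statements merged into one kernel-verified Lean document; each statement's English description precedes it below -/
import Mathlib

section
/- Let b₁, …, b_m : ℝ² → ℝ be differentiable basis functions, p₁, …, p_n ∈ ℝ² nodes with n ≥ m, B the n×m matrix B_{ji} = b_i(p_j), and W an n×n diagonal matrix with strictly positive diagonal entries such that WB has full column rank. Define the derivative shape function χ^{∂x}(p) = (∂b/∂x)(p)ᵀ (Bᵀ W² B)⁻¹ Bᵀ W², where (∂b/∂x)(p) is the vector of x-partial derivatives of the basis functions at p. Then for every q = Σᵢ cᵢ bᵢ in the span of the basis, χ^{∂x}(p) · (q(p₁), …, q(p_n)) = (∂q/∂x)(p) for all p ∈ ℝ²; i.e., the MLSM approximation of the first derivative is exact on the span of the basis. -/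
open Matrix

/-- If `A` has full column rank, then its Gram matrix `Aᵀ * A` is invertible. -/
theorem isUnit_det_transpose_mul_self_of_injective {ι κ : Type*} [Fintype ι] [Fintype κ]
    [DecidableEq κ] (A : Matrix ι κ ℝ) (hA : Function.Injective A.mulVec) :
    IsUnit (Aᵀ * A).det := by
  have h := Matrix.PosDef.conjTranspose_mul_self A hA
  rw [Matrix.conjTranspose_eq_transpose_of_trivial] at h
  exact h.det_pos.ne'.isUnit

/-- With differentiable basis functions `bf i : ℝ² → ℝ`, nodes
`pts j ∈ ℝ²` (`n ≥ m`), collocation matrix `B j i = bf i (pts j)`, diagonal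
`W` with positive entries such that `WB` has full column rank, the derivative
shape function `χ^{∂x}(p) = (∂b/∂x)(p)ᵀ (Bᵀ W² B)⁻¹ Bᵀ W²` is exact for the
`x`-derivative on the span of the basis:
`χ^{∂x}(p) ⬝ (q(p₁),…,q(p_n)) = (∂q/∂x)(p)` for every `q = Σᵢ cᵢ bᵢ`. -/
theorem wls_derivative_shape_function_exact
    (n m : ℕ) (hnm : m ≤ n)
    (bf : Fin m → (ℝ × ℝ) → ℝ) (hdiff : ∀ i, Differentiable ℝ (bf i))
    (pts : Fin n → ℝ × ℝ)
    (B : Matrix (Fin n) (Fin m) ℝ) (hB : ∀ j i, B j i = bf i (pts j))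
    (W : Matrix (Fin n) (Fin n) ℝ) (w : Fin n → ℝ)
    (hW : W = Matrix.diagonal w) (hw : ∀ j, 0 < w j)
    (hrank : Function.Injective (W * B).mulVec)
    (χdx : (ℝ × ℝ) → (Fin n → ℝ))
    (hχdx : ∀ p, χdx p =
      Matrix.vecMul (fun i => fderiv ℝ (bf i) p (1, 0))
        ((Bᵀ * W ^ 2 * B)⁻¹ * Bᵀ * W ^ 2)) :
    ∀ (c : Fin m → ℝ) (p : ℝ × ℝ),
      χdx p ⬝ᵥ (fun j => ∑ i, c i * bf i (pts j)) =
        fderiv ℝ (fun q => ∑ i, c i * bf i q) p (1, 0) := by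
  intro c p
  have hgram : Bᵀ * W ^ 2 * B = (W * B)ᵀ * (W * B) := by
    rw [Matrix.transpose_mul, hW, Matrix.diagonal_transpose, pow_two]
    simp only [Matrix.mul_assoc]
  have hunit : IsUnit (Bᵀ * W ^ 2 * B).det := by
    rw [hgram]
    exact isUnit_det_transpose_mul_self_of_injective _ hrank
  have hq : (fun j => ∑ i, c i * bf i (pts j)) = B *ᵥ c := by
    funext j
    simp only [Matrix.mulVec, dotProduct, hB, mul_comm]
  have hderiv : fderiv ℝ (fun q => ∑ i, c i * bf i q) p =
      ∑ i, c i • fderiv ℝ (bf i) p := by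
    rw [fderiv_fun_sum fun i _ => (hdiff i p).const_mul (c i)]
    exact Finset.sum_congr rfl fun i _ => fderiv_const_mul (hdiff i p) (c i)
  rw [hχdx, hq, ← Matrix.dotProduct_mulVec, Matrix.mulVec_mulVec, Matrix.mul_assoc,
    Matrix.mul_assoc, ← Matrix.mul_assoc Bᵀ, Matrix.nonsing_inv_mul _ hunit,
    Matrix.one_mulVec, hderiv]
  simp [dotProduct, mul_comm]
end

section
/- Let P, R, E* be positive reals, b = 2√(P R / (π E*)), p₀ = √(P E* / (π R)), and let σ_yy and σ_xy be the Hertz stress components σ_yy(x,y) = −(p₀/b) m (1 − (y² + n²)/(m² + n²)) and σ_xy(x,y) = (p₀/b) n (m² − y²)/(m² + n²), where m = √(m²), n = sgn(x)√(n²), m² = (S + b² − x² + y²)/2, n² = (S − (b² − x² + y²))/2, S = √((b² − x² + y²)² + 4x²y²). Then for every x with |x| ≠ b, the surface traction matches the prescribed pressure: σ_yy(x, 0) = −p(x) and σ_xy(x, 0) = 0, where p(x) = p₀√(1 − x²/b²) for |x| ≤ b and p(x) = 0 otherwise. -/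
/-- The Hertz stress components `σ_yy` and `σ_xy` match the
prescribed surface pressure: for every `x` with `|x| ≠ b`,
`σ_yy(x,0) = −p(x)` and `σ_xy(x,0) = 0`, where
`p(x) = p₀√(1 − x²/b²)` for `|x| ≤ b` and `p(x) = 0` otherwise. -/
theorem hertz_surface_traction_matches_pressure
    (P R Estar : ℝ) (hP : 0 < P) (hR : 0 < R) (hE : 0 < Estar) :
    let b := 2 * Real.sqrt (P * R / (Real.pi * Estar))
    let p0 := Real.sqrt (P * Estar / (Real.pi * R))
    let p : ℝ → ℝ := fun x => if |x| ≤ b then p0 * Real.sqrt (1 - x ^ 2 / b ^ 2) else 0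
    let S : ℝ → ℝ → ℝ := fun x y =>
      Real.sqrt ((b ^ 2 - x ^ 2 + y ^ 2) ^ 2 + 4 * x ^ 2 * y ^ 2)
    let m2 : ℝ → ℝ → ℝ := fun x y => (S x y + (b ^ 2 - x ^ 2 + y ^ 2)) / 2
    let n2 : ℝ → ℝ → ℝ := fun x y => (S x y - (b ^ 2 - x ^ 2 + y ^ 2)) / 2
    let m : ℝ → ℝ → ℝ := fun x y => Real.sqrt (m2 x y)
    let n : ℝ → ℝ → ℝ := fun x y => Real.sign x * Real.sqrt (n2 x y)
    let σyy : ℝ → ℝ → ℝ := fun x y =>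
      -(p0 / b) * m x y * (1 - (y ^ 2 + n2 x y) / (m2 x y + n2 x y))
    let σxy : ℝ → ℝ → ℝ := fun x y =>
      (p0 / b) * n x y * ((m2 x y - y ^ 2) / (m2 x y + n2 x y))
    ∀ x : ℝ, |x| ≠ b → σyy x 0 = -(p x) ∧ σxy x 0 = 0 := by
  intro b p0 p S m2 n2 m n σyy σxy x hx
  have hb : 0 < b := by positivity
  rcases lt_or_gt_of_ne hx with h | h
  · have hd : 0 < b ^ 2 - x ^ 2 := sub_pos.2 (sq_lt_sq.2 (by rwa [abs_of_pos hb]))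
    have hS : S x 0 = b ^ 2 - x ^ 2 := by simp [S, Real.sqrt_sq hd.le]
    have hm2 : m2 x 0 = b ^ 2 - x ^ 2 := by simp only [m2, hS]; ring
    have hn2 : n2 x 0 = 0 := by simp only [n2, hS]; ring
    have hp : Real.sqrt (1 - x ^ 2 / b ^ 2) = Real.sqrt (b ^ 2 - x ^ 2) / b := by
      rw [one_sub_div (pow_ne_zero 2 hb.ne'), Real.sqrt_div hd.le, Real.sqrt_sq hb.le]
    constructor
    · simp only [σyy, m, p, hm2, hn2, if_pos h.le, hp]
      ring
    · simp [σxy, n, hn2]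
  · have hd : b ^ 2 - x ^ 2 < 0 := sub_neg.2 (sq_lt_sq.2 (by rwa [abs_of_pos hb]))
    have hS : S x 0 = -(b ^ 2 - x ^ 2) := by
      simp [S, Real.sqrt_sq_eq_abs, abs_of_neg hd]
    have hm2 : m2 x 0 = 0 := by simp only [m2, hS]; ring
    constructor
    · simp [σyy, m, p, hm2, not_le.2 h]
    · simp [σxy, hm2]
end

section
/- Let P, R, E* be positive reals, b = 2√(P R / (π E*)), p₀ = √(P E* / (π R)), and let σ_xx be the Hertz stress component σ_xx(x,y) = −(p₀/b) [ m (1 + (y² + n²)/(m² + n²)) + 2y ], where m = √(m²), n = sgn(x)√(n²), m² = (S + b² − x² + y²)/2, n² = (S − (b² − x² + y²))/2, S = √((b² − x² + y²)² + 4x²y²). Then for every x with |x| ≠ b, the horizontal surface stress equals minus the contact pressure: σ_xx(x, 0) = −p(x), where p(x) = p₀√(1 − x²/b²) for |x| ≤ b and p(x) = 0 otherwise. -/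
/-- The Hertz stress component `σ_xx` equals minus the contact
pressure on the surface: for every `x` with `|x| ≠ b`, `σ_xx(x,0) = −p(x)`,
where `p(x) = p₀√(1 − x²/b²)` for `|x| ≤ b` and `p(x) = 0` otherwise. -/
theorem hertz_sigma_xx_surface_value
    (P R Estar : ℝ) (hP : 0 < P) (hR : 0 < R) (hE : 0 < Estar) :
    let b := 2 * Real.sqrt (P * R / (Real.pi * Estar))
    let p0 := Real.sqrt (P * Estar / (Real.pi * R))
    let p : ℝ → ℝ := fun x => if |x| ≤ b then p0 * Real.sqrt (1 - x ^ 2 / b ^ 2) else 0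
    let S : ℝ → ℝ → ℝ := fun x y =>
      Real.sqrt ((b ^ 2 - x ^ 2 + y ^ 2) ^ 2 + 4 * x ^ 2 * y ^ 2)
    let m2 : ℝ → ℝ → ℝ := fun x y => (S x y + (b ^ 2 - x ^ 2 + y ^ 2)) / 2
    let n2 : ℝ → ℝ → ℝ := fun x y => (S x y - (b ^ 2 - x ^ 2 + y ^ 2)) / 2
    let m : ℝ → ℝ → ℝ := fun x y => Real.sqrt (m2 x y)
    let σxx : ℝ → ℝ → ℝ := fun x y =>
      -(p0 / b) * (m x y * (1 + (y ^ 2 + n2 x y) / (m2 x y + n2 x y)) + 2 * y)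
    ∀ x : ℝ, |x| ≠ b → σxx x 0 = -(p x) := by
  intro b p0 p S m2 n2 m σxx x hx
  have hb : 0 < b := by positivity
  have hS : S x 0 = |b ^ 2 - x ^ 2| := by
    simp only [S]
    rw [← Real.sqrt_sq_eq_abs]
    ring_nf
  rcases lt_or_gt_of_ne hx with h | h
  · have hpos : 0 < b ^ 2 - x ^ 2 := sub_pos.2 (sq_lt_sq.2 (h.trans_eq (abs_of_pos hb).symm))
    have hm2 : m2 x 0 = b ^ 2 - x ^ 2 := by
      simp only [m2, hS, abs_of_pos hpos]
      ring
    have hn2 : n2 x 0 = 0 := by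
      simp only [n2, hS, abs_of_pos hpos]
      ring
    have hsqrt : Real.sqrt (1 - x ^ 2 / b ^ 2) = Real.sqrt (b ^ 2 - x ^ 2) / b := by
      rw [one_sub_div (pow_pos hb 2).ne', Real.sqrt_div hpos.le, Real.sqrt_sq hb.le]
    simp only [σxx, m, p, if_pos h.le, hm2, hn2, hsqrt]
    ring
  · have hneg : b ^ 2 - x ^ 2 < 0 := sub_neg.2 (sq_lt_sq.2 ((abs_of_pos hb).trans_lt h))
    have hm2 : m2 x 0 = 0 := by
      simp only [m2, hS, abs_of_neg hneg]
      ring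
    simp [σxx, m, p, not_le.2 h, hm2]
end

section
/- Let b > 0 and p₀ > 0, and on the open lower half-plane {(x,y) ∈ ℝ² : y < 0} define the Hertz stress field σ_xx = −(p₀/b)[ m (1 + (y² + n²)/(m² + n²)) + 2y ], σ_yy = −(p₀/b) m (1 − (y² + n²)/(m² + n²)), σ_xy = (p₀/b) n (m² − y²)/(m² + n²), where S = √((b² − x² + y²)² + 4x²y²), m² = (S + b² − x² + y²)/2, n² = (S − (b² − x² + y²))/2, m = √(m²), n = sgn(x)√(n²). Then m² + n² > 0 throughout the open lower half-plane, the three stress components are differentiable there, and they satisfy the equilibrium equations ∂σ_xx/∂x + ∂σ_xy/∂y = 0 and ∂σ_xy/∂x + ∂σ_yy/∂y = 0 at every point with y < 0. -/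
/-- For `y ≠ 0` the number `m²` is positive. -/
lemma hertz_m_sq_pos {b x y : ℝ} (hy : y ≠ 0) :
    0 < (√((b ^ 2 - x ^ 2 + y ^ 2) ^ 2 + 4 * x ^ 2 * y ^ 2) + (b ^ 2 - x ^ 2 + y ^ 2)) / 2 := by
  have hy2 : 0 < y ^ 2 := by positivity
  rcases lt_or_ge 0 (b ^ 2 - x ^ 2 + y ^ 2) with h | h
  · positivity
  · have hx : 0 < x ^ 2 := by nlinarith
    have : -(b ^ 2 - x ^ 2 + y ^ 2) < √((b ^ 2 - x ^ 2 + y ^ 2) ^ 2 + 4 * x ^ 2 * y ^ 2) := by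
      apply Real.lt_sqrt_of_sq_lt
      nlinarith [mul_pos hx hy2]
    linarith

/-- The linear form on `ℝ × ℝ` with partial derivatives `a` and `c`. -/
noncomputable def linearForm (a c : ℝ) : ℝ × ℝ →L[ℝ] ℝ :=
  a • ContinuousLinearMap.fst ℝ ℝ ℝ + c • ContinuousLinearMap.snd ℝ ℝ ℝ

lemma linearForm_apply (a c : ℝ) (v : ℝ × ℝ) : linearForm a c v = a * v.1 + c * v.2 := by
  simp [linearForm]

/-- The quotient rule for real-valued functions on a normed space. -/
lemma HasFDerivAt.real_div {E : Type*} [NormedAddCommGroup E] [NormedSpace ℝ E] {f g : E → ℝ}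
    {f' g' : E →L[ℝ] ℝ} {x : E} (hf : HasFDerivAt f f' x) (hg : HasFDerivAt g g' x)
    (hx : g x ≠ 0) :
    HasFDerivAt (fun y => f y / g y) ((g x ^ 2)⁻¹ • (g x • f' - f x • g')) x := by
  have h := hf.mul ((hasDerivAt_inv hx).comp_hasFDerivAt x hg)
  refine HasFDerivAt.congr_fderiv h (ContinuousLinearMap.ext fun v => ?_)
  simp only [Function.comp_apply, add_apply, sub_apply, smul_apply, smul_eq_mul]
  field_simp
  ring

/-- The derivative of `m`, where `m + i n` is a square root of `b² - (x + i y)²`. -/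
lemma hasFDerivAt_hertz_m {b : ℝ} (q : ℝ × ℝ) {m n : ℝ} (hm : 0 < m)
    (hS : √((b ^ 2 - q.1 ^ 2 + q.2 ^ 2) ^ 2 + 4 * q.1 ^ 2 * q.2 ^ 2) = m ^ 2 + n ^ 2)
    (hD : b ^ 2 - q.1 ^ 2 + q.2 ^ 2 = m ^ 2 - n ^ 2) (hmn : m * n = -(q.1 * q.2)) :
    HasFDerivAt (fun q : ℝ × ℝ => √((√((b ^ 2 - q.1 ^ 2 + q.2 ^ 2) ^ 2 + 4 * q.1 ^ 2 * q.2 ^ 2)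
        + (b ^ 2 - q.1 ^ 2 + q.2 ^ 2)) / 2))
      (linearForm (-(q.1 * m + q.2 * n) / (m ^ 2 + n ^ 2))
        ((q.2 * m - q.1 * n) / (m ^ 2 + n ^ 2))) q := by
  have hpos : 0 < m ^ 2 + n ^ 2 := by positivity
  have hx : HasFDerivAt (fun q : ℝ × ℝ => q.1) (ContinuousLinearMap.fst ℝ ℝ ℝ) q := hasFDerivAt_fst
  have hy : HasFDerivAt (fun q : ℝ × ℝ => q.2) (ContinuousLinearMap.snd ℝ ℝ ℝ) q := hasFDerivAt_snd
  have hDd : HasFDerivAt (fun q : ℝ × ℝ => b ^ 2 - q.1 ^ 2 + q.2 ^ 2) _ q :=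
    ((hx.pow 2).const_sub (b ^ 2)).add (hy.pow 2)
  have hPd : HasFDerivAt (fun q : ℝ × ℝ => (b ^ 2 - q.1 ^ 2 + q.2 ^ 2) ^ 2
      + 4 * q.1 ^ 2 * q.2 ^ 2) _ q :=
    (hDd.pow 2).add (((hx.pow 2).const_mul 4).mul (hy.pow 2))
  have hP0 : (b ^ 2 - q.1 ^ 2 + q.2 ^ 2) ^ 2 + 4 * q.1 ^ 2 * q.2 ^ 2 ≠ 0 := by
    intro h
    rw [h, Real.sqrt_zero] at hS
    linarith
  have hm2 : (m ^ 2 + n ^ 2 + (b ^ 2 - q.1 ^ 2 + q.2 ^ 2)) / 2 = m ^ 2 := by rw [hD]; ring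
  have h := (((hPd.sqrt hP0).add hDd).mul_const (1 / 2 : ℝ)).sqrt (by
    simp only [Pi.add_apply, mul_one_div, hS, hm2]
    positivity)
  simp only [Pi.add_apply, mul_one_div, hS, hm2, Real.sqrt_sq hm.le] at h
  refine h.congr_fderiv (ContinuousLinearMap.ext fun v => ?_)
  rw [linearForm_apply]
  simp only [add_apply, smul_apply, neg_apply, hD, ContinuousLinearMap.coe_fst',
    ContinuousLinearMap.coe_snd',
    smul_eq_mul, nsmul_eq_mul, Nat.cast_ofNat, Nat.add_one_sub_one, pow_one]
  field_simp
  linear_combination 4 * (q.1 * v.2 + q.2 * v.1) * hmn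

/-- The derivative of `n = -x y / m`, from the Cauchy-Riemann equations. -/
lemma hasFDerivAt_hertz_n {m : ℝ × ℝ → ℝ} {q : ℝ × ℝ} {n : ℝ}
    (hm : 0 < m q) (hmn : m q * n = -(q.1 * q.2))
    (hmd : HasFDerivAt m (linearForm (-(q.1 * m q + q.2 * n) / (m q ^ 2 + n ^ 2))
        ((q.2 * m q - q.1 * n) / (m q ^ 2 + n ^ 2))) q) :
    HasFDerivAt (fun q => -(q.1 * q.2) / m q)
      (linearForm (-(q.2 * m q - q.1 * n) / (m q ^ 2 + n ^ 2))
        (-(q.1 * m q + q.2 * n) / (m q ^ 2 + n ^ 2))) q := by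
  have hpos : m q ^ 2 + n ^ 2 ≠ 0 := by positivity
  have hx : HasFDerivAt (fun q : ℝ × ℝ => q.1) (ContinuousLinearMap.fst ℝ ℝ ℝ) q := hasFDerivAt_fst
  have hy : HasFDerivAt (fun q : ℝ × ℝ => q.2) (ContinuousLinearMap.snd ℝ ℝ ℝ) q := hasFDerivAt_snd
  have h : HasFDerivAt (fun q : ℝ × ℝ => -(q.1 * q.2) / m q) _ q := (hx.mul hy).neg.real_div hmd hm.ne'
  refine h.congr_fderiv (ContinuousLinearMap.ext fun v => ?_)
  simp only [linearForm_apply, add_apply, sub_apply, smul_apply, neg_apply, Pi.neg_apply,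
    Pi.mul_apply, ContinuousLinearMap.coe_fst', ContinuousLinearMap.coe_snd', smul_eq_mul, ← hmn]
  field_simp
  ring

/-- The square root `m + i n` of `b² - (x + i y)²` in real coordinates. -/
lemma hertz_parametrization {b x y m n : ℝ} (hy : y < 0)
    (hm : m = √((√((b ^ 2 - x ^ 2 + y ^ 2) ^ 2 + 4 * x ^ 2 * y ^ 2)
      + (b ^ 2 - x ^ 2 + y ^ 2)) / 2)) (hn : n = -(x * y) / m) :
    0 < m ∧ √((b ^ 2 - x ^ 2 + y ^ 2) ^ 2 + 4 * x ^ 2 * y ^ 2) = m ^ 2 + n ^ 2 ∧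
      b ^ 2 - x ^ 2 + y ^ 2 = m ^ 2 - n ^ 2 ∧ m * n = -(x * y) ∧
      Real.sign x * √(n ^ 2) = n := by
  have hA := hertz_m_sq_pos (b := b) (x := x) hy.ne
  have hm0 : 0 < m := hm ▸ Real.sqrt_pos.2 hA
  have hmm := Real.sq_sqrt hA.le
  rw [← hm] at hmm
  have hS := Real.sq_sqrt (show 0 ≤ (b ^ 2 - x ^ 2 + y ^ 2) ^ 2 + 4 * x ^ 2 * y ^ 2 by positivity)
  set S := √((b ^ 2 - x ^ 2 + y ^ 2) ^ 2 + 4 * x ^ 2 * y ^ 2)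
  have hmn : m * n = -(x * y) := by rw [hn]; field_simp
  have hn2 : n ^ 2 = (S - (b ^ 2 - x ^ 2 + y ^ 2)) / 2 := by
    have h0 : m ^ 2 ≠ 0 := by positivity
    apply mul_left_cancel₀ h0
    rw [← mul_pow, hmn, hmm]
    linear_combination -hS / 4
  refine ⟨hm0, by linarith, by linarith, hmn, ?_⟩
  rw [Real.sqrt_sq_eq_abs, hn, abs_div, abs_neg, abs_mul, abs_of_neg hy, abs_of_pos hm0]
  rcases lt_trichotomy x 0 with h | rfl | h
  · rw [Real.sign_of_neg h, abs_of_neg h]; ring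
  · simp
  · rw [Real.sign_of_pos h, abs_of_pos h]; ring

/-- Equilibrium of the Hertz stress field in terms of conjugate functions `m` and `n`. -/
lemma hertz_equilibrium_of_hasFDerivAt {c : ℝ} {m n : ℝ × ℝ → ℝ} {q : ℝ × ℝ} (hq : q.2 ≠ 0)
    (hm : 0 < m q) (hmn : m q * n q = -(q.1 * q.2))
    (hmd : HasFDerivAt m (linearForm (-(q.1 * m q + q.2 * n q) / (m q ^ 2 + n q ^ 2))
        ((q.2 * m q - q.1 * n q) / (m q ^ 2 + n q ^ 2))) q)
    (hnd : HasFDerivAt n (linearForm (-(q.2 * m q - q.1 * n q) / (m q ^ 2 + n q ^ 2))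
        (-(q.1 * m q + q.2 * n q) / (m q ^ 2 + n q ^ 2))) q) :
    let σxx : ℝ × ℝ → ℝ := fun q =>
      -c * (m q * (1 + (q.2 ^ 2 + n q ^ 2) / (m q ^ 2 + n q ^ 2)) + 2 * q.2)
    let σyy : ℝ × ℝ → ℝ := fun q =>
      -c * m q * (1 - (q.2 ^ 2 + n q ^ 2) / (m q ^ 2 + n q ^ 2))
    let σxy : ℝ × ℝ → ℝ := fun q =>
      c * n q * ((m q ^ 2 - q.2 ^ 2) / (m q ^ 2 + n q ^ 2))
    DifferentiableAt ℝ σxx q ∧ DifferentiableAt ℝ σyy q ∧ DifferentiableAt ℝ σxy q ∧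
      fderiv ℝ σxx q (1, 0) + fderiv ℝ σxy q (0, 1) = 0 ∧
      fderiv ℝ σxy q (1, 0) + fderiv ℝ σyy q (0, 1) = 0 := by
  intro σxx σyy σxy
  have hpos : m q ^ 2 + n q ^ 2 ≠ 0 := by positivity
  have hy : HasFDerivAt (fun q : ℝ × ℝ => q.2) (ContinuousLinearMap.snd ℝ ℝ ℝ) q := hasFDerivAt_snd
  have hr := ((hy.pow 2).add (hnd.pow 2)).real_div ((hmd.pow 2).add (hnd.pow 2)) hpos
  have hxx : HasFDerivAt σxx _ q :=
    ((hmd.mul (hr.const_add 1)).add (hy.const_mul 2)).const_mul (-c)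
  have hyy : HasFDerivAt σyy _ q := (hmd.const_mul (-c)).mul (hr.const_sub 1)
  have hxy : HasFDerivAt σxy _ q := (hnd.const_mul c).mul
    (((hmd.pow 2).sub (hy.pow 2)).real_div ((hmd.pow 2).add (hnd.pow 2)) hpos)
  refine ⟨hxx.differentiableAt, hyy.differentiableAt, hxy.differentiableAt, ?_, ?_⟩
  all_goals
    have hx : q.1 = -(m q * n q) / q.2 := by rw [hmn]; field_simp
    simp only [hxx.fderiv, hyy.fderiv, hxy.fderiv, Pi.add_apply, Pi.sub_apply,
      add_apply, sub_apply, smul_apply, neg_apply, linearForm_apply,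
      ContinuousLinearMap.coe_snd', smul_eq_mul, nsmul_eq_mul, Nat.cast_ofNat, Nat.add_one_sub_one,
      pow_one]
    rw [hx]
    generalize m q = u at *
    generalize n q = v at *
    generalize q.2 = y at *
    field_simp
    ring

/-- On the open lower half-plane `{(x,y) : y < 0}` the Hertz
stress field has `m² + n² > 0`, its three components are differentiable, and
they satisfy the equilibrium equations
`∂σ_xx/∂x + ∂σ_xy/∂y = 0` and `∂σ_xy/∂x + ∂σ_yy/∂y = 0`. -/
theorem hertz_stress_equilibrium_lower_half_plane
    (b p0 : ℝ) (hb : 0 < b) (hp0 : 0 < p0) :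
    let S : ℝ × ℝ → ℝ := fun q =>
      Real.sqrt ((b ^ 2 - q.1 ^ 2 + q.2 ^ 2) ^ 2 + 4 * q.1 ^ 2 * q.2 ^ 2)
    let m2 : ℝ × ℝ → ℝ := fun q => (S q + (b ^ 2 - q.1 ^ 2 + q.2 ^ 2)) / 2
    let n2 : ℝ × ℝ → ℝ := fun q => (S q - (b ^ 2 - q.1 ^ 2 + q.2 ^ 2)) / 2
    let m : ℝ × ℝ → ℝ := fun q => Real.sqrt (m2 q)
    let n : ℝ × ℝ → ℝ := fun q => Real.sign q.1 * Real.sqrt (n2 q)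
    let σxx : ℝ × ℝ → ℝ := fun q =>
      -(p0 / b) * (m q * (1 + (q.2 ^ 2 + n2 q) / (m2 q + n2 q)) + 2 * q.2)
    let σyy : ℝ × ℝ → ℝ := fun q =>
      -(p0 / b) * m q * (1 - (q.2 ^ 2 + n2 q) / (m2 q + n2 q))
    let σxy : ℝ × ℝ → ℝ := fun q =>
      (p0 / b) * n q * ((m2 q - q.2 ^ 2) / (m2 q + n2 q))
    ∀ q : ℝ × ℝ, q.2 < 0 →
      0 < m2 q + n2 q ∧
      DifferentiableAt ℝ σxx q ∧ DifferentiableAt ℝ σyy q ∧ DifferentiableAt ℝ σxy q ∧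
      fderiv ℝ σxx q (1, 0) + fderiv ℝ σxy q (0, 1) = 0 ∧
      fderiv ℝ σxy q (1, 0) + fderiv ℝ σyy q (0, 1) = 0 := by
  intro S m2 n2 m n σxx σyy σxy q hq
  let N : ℝ × ℝ → ℝ := fun q => -(q.1 * q.2) / m q
  have key : ∀ r : ℝ × ℝ, r.2 < 0 → 0 < m r ∧ m2 r = m r ^ 2 ∧ n2 r = N r ^ 2 ∧ n r = N r := by
    intro r hr
    obtain ⟨h0, hS, hD, -, hs⟩ :=
      hertz_parametrization (b := b) (x := r.1) (y := r.2) (m := m r) (n := N r) hr rfl rfl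
    have hm2 : m2 r = m r ^ 2 := by simp only [m2, S, hS]; rw [hD]; ring
    have hn2 : n2 r = N r ^ 2 := by simp only [n2, S, hS]; rw [hD]; ring
    exact ⟨h0, hm2, hn2, by simp only [n, hn2, hs]⟩
  obtain ⟨hm0, hS, hD, hmn, -⟩ :=
    hertz_parametrization (b := b) (x := q.1) (y := q.2) (m := m q) (n := N q) hq rfl rfl
  have hmd := hasFDerivAt_hertz_m q hm0 hS hD hmn
  have hnd := hasFDerivAt_hertz_n hm0 hmn hmd
  have hnhds : ∀ᶠ r in nhds q, r.2 < 0 :=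
    continuous_snd.continuousAt.eventually_lt continuousAt_const hq
  obtain ⟨dxx, dyy, dxy, e₁, e₂⟩ :=
    hertz_equilibrium_of_hasFDerivAt (c := p0 / b) hq.ne hm0 hmn hmd hnd
  have hxx : σxx =ᶠ[nhds q] _ := hnhds.mono fun r hr => by
    obtain ⟨-, h₁, h₂, -⟩ := key r hr
    simp only [σxx, h₁, h₂]
    exact rfl
  have hyy : σyy =ᶠ[nhds q] _ := hnhds.mono fun r hr => by
    obtain ⟨-, h₁, h₂, -⟩ := key r hr
    simp only [σyy, h₁, h₂]
    exact rfl
  have hxy : σxy =ᶠ[nhds q] _ := hnhds.mono fun r hr => by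
    obtain ⟨-, h₁, h₂, h₃⟩ := key r hr
    simp only [σxy, h₁, h₂, h₃]
    exact rfl
  refine ⟨?_, dxx.congr_of_eventuallyEq hxx, dyy.congr_of_eventuallyEq hyy,
    dxy.congr_of_eventuallyEq hxy, ?_, ?_⟩
  · obtain ⟨-, h₁, h₂, -⟩ := key q hq
    rw [h₁, h₂]
    positivity
  · rw [hxx.fderiv_eq, hxy.fderiv_eq]
    exact e₁
  · rw [hxy.fderiv_eq, hyy.fderiv_eq]
    exact e₂
end
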